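/- Fix α ∈ (0,1), n ≥ 1, and m ≥ 1. Let α_0 + α_1 = α with α_0, α_1 > 0, and define r = ⌈( n(n−1)/(n+2m) − 2√( n(n−1)/(n+2m) · log(1/α_0) ) )_+⌉. Then L̂^{pwc,r}_α(F_pwc^(m), D_n) := α_1 · R̂(F_pwc^(n−r), D_n) is a valid distribution-free lower bound on R_P(F_pwc^(m)); that is, for every probability distribution P on ℝ^d × ℝ, P^n{ D_n : R_P(F_pwc^(m)) ≥ α_1 · R̂(F_pwc^(n−r), D_n) } ≥ 1 − α. -/

import Mathlib

open MeasureTheory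
open scoped ENNReal NNReal BigOperators

/-- The class of piecewise constant functions `ℝ^d → ℝ` taking at most `m` values. -/
def Fpwc (d m : ℕ) : Set ((Fin d → ℝ) → ℝ) :=
  {f | ∃ s : Finset ℝ, s.card ≤ m ∧ ∀ x, f x ∈ s}

/-- Model class risk of `Fpwc d m` under squared loss. -/
noncomputable def pwcClassRisk (d m : ℕ) (P : Measure ((Fin d → ℝ) × ℝ)) : ℝ≥0∞ :=
  ⨅ f ∈ Fpwc d m, ∫⁻ z, ENNReal.ofReal ((f z.1 - z.2) ^ 2) ∂P

/-- Empirical model class risk of `Fpwc d m` under squared loss. -/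
noncomputable def pwcEmpClassRisk (d m n : ℕ) (D : Fin n → (Fin d → ℝ) × ℝ) : ℝ≥0∞ :=
  ⨅ f ∈ Fpwc d m, (∑ i, ENNReal.ofReal ((f (D i).1 - (D i).2) ^ 2)) / n

lemma sum_prod_weights {ι : Type*} [Fintype ι] (p : ι → ℝ) (hp1 : ∑ j, p j = 1) (n : ℕ) :
    ∑ u : Fin n → ι, ∏ i, p (u i) = 1 := by
  classical
  rw [← Fintype.sum_pow, hp1, one_pow]

section Finite
variable {ι : Type*} [Fintype ι] [DecidableEq ι]

/-- Swapping two labels shows that the more likely label is the more likely to be hit, also after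
reweighting by a function of the number of distinct labels. -/
lemma sum_hit_le_sum_hit {n : ℕ} {p : ι → ℝ} (hp : ∀ j, 0 ≤ p j) {φ : ℕ → ℝ}
    (hφ : ∀ k, 0 ≤ φ k) {j k : ι} (hjk : p k ≤ p j) :
    ∑ u : Fin n → ι, (if k ∈ Finset.univ.image u then
        (∏ i, p (u i)) * φ (Finset.univ.image u).card else 0) ≤
      ∑ u : Fin n → ι, (if j ∈ Finset.univ.image u then
        (∏ i, p (u i)) * φ (Finset.univ.image u).card else 0) := by
  classical
  set W : (Fin n → ι) → ℝ := fun u => (∏ i, p (u i)) * φ (Finset.univ.image u).card with hW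
  have hsplit : ∀ a b : ι, ∑ u : Fin n → ι, (if a ∈ Finset.univ.image u then W u else 0) =
      ∑ u : Fin n → ι,
        (if a ∈ Finset.univ.image u ∧ b ∈ Finset.univ.image u then W u else 0) +
      ∑ u : Fin n → ι,
        (if a ∈ Finset.univ.image u ∧ b ∉ Finset.univ.image u then W u else 0) := by
    intro a b
    rw [← Finset.sum_add_distrib]
    refine Finset.sum_congr rfl fun u _ => ?_
    by_cases h1 : a ∈ Finset.univ.image u <;> by_cases h2 : b ∈ Finset.univ.image u <;>
      simp only [h1, h2, if_true, if_false, and_true, and_false, not_true, not_false_eq_true,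
        add_zero, zero_add]
  change ∑ u : Fin n → ι, (if k ∈ Finset.univ.image u then W u else 0) ≤
    ∑ u : Fin n → ι, (if j ∈ Finset.univ.image u then W u else 0)
  rw [hsplit k j, hsplit j k]
  refine add_le_add (le_of_eq ?_) ?_
  · exact Finset.sum_congr rfl fun u _ => by simp only [and_comm]
  · rw [← (Equiv.arrowCongr (Equiv.refl (Fin n)) (Equiv.swap j k)).sum_comp]
    refine Finset.sum_le_sum fun u _ => ?_
    have himg : Finset.univ.image ((Equiv.arrowCongr (Equiv.refl (Fin n)) (Equiv.swap j k)) u) =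
        (Finset.univ.image u).map (Equiv.swap j k).toEmbedding := by
      ext a
      simp [Equiv.arrowCongr, Equiv.swap_apply_eq_iff]
    have hk : k ∈ (Finset.univ.image u).map (Equiv.swap j k).toEmbedding ↔
        j ∈ Finset.univ.image u := by
      rw [Finset.mem_map_equiv]; simp
    have hj : j ∈ (Finset.univ.image u).map (Equiv.swap j k).toEmbedding ↔
        k ∈ Finset.univ.image u := by
      rw [Finset.mem_map_equiv]; simp
    simp only [himg, hk, hj]
    split_ifs with h
    · simp only [hW]
      rw [himg, Finset.card_map]
      refine mul_le_mul_of_nonneg_right ?_ (hφ _)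
      refine Finset.prod_le_prod (fun i _ => hp _) fun i _ => ?_
      have hik : u i ≠ k := fun e => h.2 (Finset.mem_image.2 ⟨i, Finset.mem_univ _, e⟩)
      change p (Equiv.swap j k (u i)) ≤ p (u i)
      by_cases hij : u i = j
      · rw [hij, Equiv.swap_apply_left]; exact hjk
      · rw [Equiv.swap_apply_of_ne_of_ne hij hik]
    · exact le_rfl

/-- The Laplace transform of the number of repetitions `n - #{distinct labels}` in a sample of
size `n` from the weights `p`. -/
noncomputable def repLaplace (p : ι → ℝ) (l : ℝ) (n : ℕ) : ℝ :=
  ∑ u : Fin n → ι, (∏ i, p (u i)) * Real.exp (-l * (n - (Finset.univ.image u).card))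

lemma repLaplace_succ (p : ι → ℝ) (hp1 : ∑ j, p j = 1) (l : ℝ) (n : ℕ) :
    repLaplace p l (n + 1) = repLaplace p l n - (1 - Real.exp (-l)) *
      ∑ j, p j * ∑ u : Fin n → ι, (if j ∈ Finset.univ.image u then
        (∏ i, p (u i)) * Real.exp (-l * (n - (Finset.univ.image u).card)) else 0) := by
  unfold repLaplace
  rw [← (Fin.consEquiv (fun _ : Fin (n + 1) => ι)).sum_comp, Fintype.sum_prod_type]
  have h1 : ∑ u : Fin n → ι, (∏ i, p (u i)) *
        Real.exp (-l * (n - (Finset.univ.image u).card)) =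
      ∑ j, p j * ∑ u : Fin n → ι, (∏ i, p (u i)) *
        Real.exp (-l * (n - (Finset.univ.image u).card)) := by
    rw [← Finset.sum_mul, hp1, one_mul]
  rw [h1, Finset.mul_sum, ← Finset.sum_sub_distrib]
  refine Finset.sum_congr rfl fun j _ => ?_
  rw [Finset.mul_sum, Finset.mul_sum, Finset.mul_sum, ← Finset.sum_sub_distrib]
  refine Finset.sum_congr rfl fun u _ => ?_
  have himg : Finset.univ.image (Fin.cons j u : Fin (n + 1) → ι) =
      insert j (Finset.univ.image u) := by
    ext a
    simp [Fin.exists_fin_succ, eq_comm]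
  change (∏ i, p ((Fin.cons j u : Fin (n + 1) → ι) i)) *
    Real.exp (-l * (((n + 1 : ℕ) : ℝ) -
      (Finset.univ.image (Fin.cons j u : Fin (n + 1) → ι)).card)) = _
  rw [himg, Fin.prod_univ_succ]
  simp only [Fin.cons_zero, Fin.cons_succ]
  by_cases h : j ∈ Finset.univ.image u
  · rw [Finset.insert_eq_of_mem h, if_pos h]
    have : -l * (((n + 1 : ℕ) : ℝ) - (Finset.univ.image u).card) =
        -l + -l * (n - (Finset.univ.image u).card) := by push_cast; ring
    rw [this, Real.exp_add]
    ring
  · rw [Finset.card_insert_of_notMem h, if_neg h]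
    push_cast
    rw [add_sub_add_right_eq_sub]
    ring

lemma repLaplace_pos (p : ι → ℝ) (hp : ∀ j, 0 ≤ p j) (hp1 : ∑ j, p j = 1) (l : ℝ) (n : ℕ) :
    0 < repLaplace p l n := by
  have hnn : ∀ u : Fin n → ι, 0 ≤ ∏ i, p (u i) := fun u => Finset.prod_nonneg fun i _ => hp _
  refine lt_of_le_of_ne (Finset.sum_nonneg fun u _ =>
    mul_nonneg (hnn u) (Real.exp_pos _).le) fun h0 => ?_
  have h := (Finset.sum_eq_zero_iff_of_nonneg (fun u _ =>
    mul_nonneg (hnn u) (Real.exp_pos _).le)).1 h0.symm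
  have : ∑ u : Fin n → ι, ∏ i, p (u i) = 0 := Finset.sum_eq_zero fun u hu =>
    (mul_eq_zero.1 (h u hu)).resolve_right (Real.exp_pos _).ne'
  rw [sum_prod_weights p hp1] at this
  exact one_ne_zero this

/-- Chebyshev's sum inequality: the next label is a repetition with (tilted) probability at least
the (tilted) mean fraction of labels already seen. -/
lemma repLaplace_succ_le (p : ι → ℝ) (hp : ∀ j, 0 ≤ p j) (hp1 : ∑ j, p j = 1) {l : ℝ}
    (hl : 0 ≤ l) {m : ℕ} (hm0 : 0 < m) (hm : Fintype.card ι ≤ m) (n : ℕ) :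
    repLaplace p l (n + 1) ≤ repLaplace p l n - (1 - Real.exp (-l)) / m *
      ∑ u : Fin n → ι, (∏ i, p (u i)) * Real.exp (-l * (n - (Finset.univ.image u).card)) *
        (Finset.univ.image u).card := by
  rw [repLaplace_succ p hp1]
  have hη : 0 ≤ 1 - Real.exp (-l) := by
    have : Real.exp (-l) ≤ 1 := Real.exp_le_one_iff.2 (by linarith)
    linarith
  set Q : ι → ℝ := fun j => ∑ u : Fin n → ι, (if j ∈ Finset.univ.image u then
        (∏ i, p (u i)) * Real.exp (-l * (n - (Finset.univ.image u).card)) else 0) with hQ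
  have hmono : Monovary p Q := by
    intro j k hlt
    by_contra! hcon
    exact absurd hlt (not_lt.2 (sum_hit_le_sum_hit hp
      (φ := fun c => Real.exp (-l * (n - c))) (fun _ => (Real.exp_pos _).le) hcon.le))
  have hcheb := hmono.sum_mul_sum_le_card_mul_sum
  have hsumQ : ∑ j, Q j = ∑ u : Fin n → ι, (∏ i, p (u i)) *
      Real.exp (-l * (n - (Finset.univ.image u).card)) * (Finset.univ.image u).card := by
    simp only [hQ]
    rw [Finset.sum_comm]
    refine Finset.sum_congr rfl fun u _ => ?_
    rw [Finset.sum_ite_mem, Finset.univ_inter, Finset.sum_const, nsmul_eq_mul]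
    ring
  have hQ0 : ∀ j, 0 ≤ Q j := fun j => Finset.sum_nonneg fun u _ => by
    split_ifs
    · exact mul_nonneg (Finset.prod_nonneg fun i _ => hp _) (Real.exp_pos _).le
    · exact le_rfl
  rw [hp1, one_mul] at hcheb
  have hm' : (0 : ℝ) < m := by exact_mod_cast hm0
  have h2 : ∑ j, Q j ≤ m * ∑ j, p j * Q j := hcheb.trans
    (mul_le_mul_of_nonneg_right (by exact_mod_cast hm)
      (Finset.sum_nonneg fun j _ => mul_nonneg (hp j) (hQ0 j)))
  rw [← hsumQ, div_mul_eq_mul_div, mul_div_assoc]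
  have h3 : (∑ j, Q j) / m ≤ ∑ j, p j * Q j := by
    rw [div_le_iff₀ hm', mul_comm]; exact h2
  exact sub_le_sub_left (mul_le_mul_of_nonneg_left h3 hη) _

/-- Convexity of the log-Laplace transform, in the form
`l * E[C e^{-lC}] ≤ -E[e^{-lC}] log E[e^{-lC}]`. -/
lemma sum_mul_rep_le (p : ι → ℝ) (hp : ∀ j, 0 ≤ p j) (hp1 : ∑ j, p j = 1) (l : ℝ) (n : ℕ) :
    ∑ u : Fin n → ι, (∏ i, p (u i)) * Real.exp (-l * (n - (Finset.univ.image u).card)) *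
        (l * (n - (Finset.univ.image u).card)) ≤
      -(repLaplace p l n * Real.log (repLaplace p l n)) := by
  set M := repLaplace p l n with hM
  have hMpos : 0 < M := repLaplace_pos p hp hp1 l n
  have key : ∀ u : Fin n → ι,
      (∏ i, p (u i)) * Real.exp (-l * (n - (Finset.univ.image u).card)) *
        (l * (n - (Finset.univ.image u).card)) ≤
      (∏ i, p (u i)) * M - (∏ i, p (u i)) *
        Real.exp (-l * (n - (Finset.univ.image u).card)) * (1 + Real.log M) := by
    intro u
    set y : ℝ := l * (n - (Finset.univ.image u).card) with hy
    have e1 : -l * (n - (Finset.univ.image u).card) = -y := by rw [hy]; ring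
    rw [e1]
    have h1 : Real.log M + y ≤ M / Real.exp (-y) - 1 := by
      have := Real.log_le_sub_one_of_pos (div_pos hMpos (Real.exp_pos (-y)))
      rwa [Real.log_div hMpos.ne' (Real.exp_pos _).ne', Real.log_exp, sub_neg_eq_add] at this
    have h2 : Real.exp (-y) * (y + 1 + Real.log M) ≤ M := by
      have h3 : y + 1 + Real.log M ≤ M / Real.exp (-y) := by linarith
      calc _ ≤ Real.exp (-y) * (M / Real.exp (-y)) :=
            mul_le_mul_of_nonneg_left h3 (Real.exp_pos _).le
        _ = M := mul_div_cancel₀ _ (Real.exp_pos _).ne'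
    have h4 := mul_le_mul_of_nonneg_left h2 (Finset.prod_nonneg fun i (_ : i ∈ Finset.univ) =>
      hp (u i))
    linarith
  refine (Finset.sum_le_sum fun u _ => key u).trans (le_of_eq ?_)
  rw [Finset.sum_sub_distrib, ← Finset.sum_mul, ← Finset.sum_mul, sum_prod_weights p hp1]
  change 1 * M - M * _ = _
  ring

lemma repLaplace_le_exp (p : ι → ℝ) (hp : ∀ j, 0 ≤ p j) (hp1 : ∑ j, p j = 1) {l : ℝ}
    (hl : 0 < l) {m : ℕ} (hm0 : 0 < m) (hm : Fintype.card ι ≤ m) (n : ℕ) :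
    repLaplace p l n ≤
      Real.exp (-l * (n * (n - 1) / (n + 2 * (l * m / (1 - Real.exp (-l)))))) := by
  have hm' : (1 : ℝ) ≤ m := by exact_mod_cast hm0
  have hη : 0 < 1 - Real.exp (-l) := by
    have : Real.exp (-l) < 1 := Real.exp_lt_one_iff.2 (by linarith)
    linarith
  have hηl : 1 - Real.exp (-l) ≤ l := by
    have := Real.add_one_le_exp (-l); linarith
  set D : ℝ := l * m / (1 - Real.exp (-l)) with hD
  have hD1 : 1 ≤ D := by
    rw [hD, le_div_iff₀ hη]; nlinarith
  induction n with
  | zero => simp [repLaplace]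
  | succ n ih =>
    set g : ℝ := n * (n - 1) / (n + 2 * D) with hg
    have h1 := repLaplace_succ_le p hp hp1 hl.le hm0 hm n
    have h2 := sum_mul_rep_le p hp hp1 l n
    have hMpos := repLaplace_pos p hp hp1 l n
    set M := repLaplace p l n with hM
    set S := ∑ u : Fin n → ι, (∏ i, p (u i)) *
      Real.exp (-l * (n - (Finset.univ.image u).card)) * (Finset.univ.image u).card with hS
    have h3 : ∑ u : Fin n → ι, (∏ i, p (u i)) *
        Real.exp (-l * (n - (Finset.univ.image u).card)) *
        (l * (n - (Finset.univ.image u).card)) = l * (n * M - S) := by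
      rw [hM, repLaplace, hS, Finset.mul_sum, ← Finset.sum_sub_distrib, Finset.mul_sum]
      exact Finset.sum_congr rfl fun u _ => by ring
    rw [h3] at h2
    have hlog : Real.log M ≤ -l * g := by
      rw [← Real.log_exp (-l * g)]; exact Real.log_le_log hMpos ih
    have hc : (1 - Real.exp (-l)) / m = l / D := by
      rw [hD]; field_simp
    rw [hc] at h1
    have hD0 : 0 < D := by linarith
    have h4 : repLaplace p l (n + 1) ≤ M * (1 - (l * n + Real.log M) / D) := by
      have : M * (l * n + Real.log M) / D ≤ l / D * S := by
        rw [div_mul_eq_mul_div]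
        refine div_le_div_of_nonneg_right ?_ hD0.le
        linarith
      calc _ ≤ M - l / D * S := h1
        _ ≤ M - M * (l * n + Real.log M) / D := by linarith
        _ = _ := by ring
    have h5 : M * (1 - (l * n + Real.log M) / D) ≤
        Real.exp (Real.log M) * Real.exp (-((l * n + Real.log M) / D)) := by
      rw [Real.exp_log hMpos]
      refine mul_le_mul_of_nonneg_left ?_ hMpos.le
      have := Real.add_one_le_exp (-((l * n + Real.log M) / D)); linarith
    refine h4.trans (h5.trans ?_)
    rw [← Real.exp_add, Real.exp_le_exp]
    have hstep : ((n + 1 : ℕ) : ℝ) * (((n + 1 : ℕ) : ℝ) - 1) / (((n + 1 : ℕ) : ℝ) + 2 * D) ≤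
        g * (1 - 1 / D) + n / D := by
      have hn0 : (0 : ℝ) ≤ n := Nat.cast_nonneg n
      have e : g * (1 - 1 / D) + n / D = n * (n * D + D + 1) / (D * (n + 2 * D)) := by
        rw [hg]; field_simp; ring
      rw [e, div_le_div_iff₀ (by positivity) (by positivity)]
      push_cast
      have : (0 : ℝ) ≤ n * ((n + 1) * D + (n + 1 + 2 * D)) := by positivity
      nlinarith
    have hd : 0 ≤ 1 - 1 / D := by
      rw [sub_nonneg, div_le_one hD0]; exact hD1
    have h6 : Real.log M * (1 - 1 / D) ≤ -l * g * (1 - 1 / D) :=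
      mul_le_mul_of_nonneg_right hlog hd
    have h7 := mul_le_mul_of_nonneg_left hstep hl.le
    have e2 : Real.log M + -((l * n + Real.log M) / D) =
        Real.log M * (1 - 1 / D) - l * (n / D) := by ring
    rw [e2]
    linarith

lemma sub_sq_half_le_one_sub_exp_neg {l : ℝ} (hl : 0 ≤ l) :
    l - l ^ 2 / 2 ≤ 1 - Real.exp (-l) := by
  have h1 := Real.quadratic_le_exp_of_nonneg hl
  have h2 : Real.exp (-l) * Real.exp l = 1 := by rw [← Real.exp_add]; simp
  have h3 : 0 < Real.exp l := Real.exp_pos l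
  have h4 : 1 ≤ (1 - l + l ^ 2 / 2) * (1 + l + l ^ 2 / 2) := by nlinarith [sq_nonneg (l ^ 2)]
  have h5 : 0 ≤ 1 - l + l ^ 2 / 2 := by nlinarith [sq_nonneg (l - 1)]
  have h6 : Real.exp (-l) * Real.exp l ≤ (1 - l + l ^ 2 / 2) * Real.exp l := by
    rw [h2]; exact h4.trans (mul_le_mul_of_nonneg_left h1 h5)
  have := le_of_mul_le_mul_right h6 h3
  linarith

/-- Lower tail bound for the number of repetitions in an i.i.d. sample of labels. -/
lemma sum_few_rep_le (p : ι → ℝ) (hp : ∀ j, 0 ≤ p j) (hp1 : ∑ j, p j = 1)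
    {m : ℕ} (hm0 : 0 < m) (hm : Fintype.card ι ≤ m) (n r : ℕ) {a : ℝ} (ha0 : 0 < a)
    (ha1 : a < 1)
    (hr : r = ⌈max ((n : ℝ) * ((n : ℝ) - 1) / ((n : ℝ) + 2 * m)
        - 2 * Real.sqrt ((n : ℝ) * ((n : ℝ) - 1) / ((n : ℝ) + 2 * m)
            * Real.log (1 / a))) 0⌉₊) :
    ∑ u : Fin n → ι, (if n - (Finset.univ.image u).card < r then ∏ i, p (u i) else 0) ≤ a := by
  have hm' : (0 : ℝ) < m := by exact_mod_cast hm0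
  have hn0 : (0 : ℝ) ≤ n := Nat.cast_nonneg n
  set μ : ℝ := (n : ℝ) * ((n : ℝ) - 1) / ((n : ℝ) + 2 * m) with hμ
  set L : ℝ := Real.log (1 / a) with hL
  have hLpos : 0 < L := Real.log_pos (by rw [lt_div_iff₀ ha0]; linarith)
  set t : ℝ := 2 * Real.sqrt (μ * L) with ht
  by_cases hpos : μ - t ≤ 0
  · have : r = 0 := by rw [hr, max_eq_right hpos]; simp
    simp [this, ha0.le]
  push Not at hpos
  have ht0 : 0 ≤ t := by positivity
  have hμ0 : 0 < μ := by linarith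
  have htpos : 0 < t := by positivity
  have htsq : t ^ 2 = 4 * (μ * L) := by
    rw [ht, mul_pow, Real.sq_sqrt (by positivity)]; ring
  set l : ℝ := t / μ with hl
  have hl0 : 0 < l := by positivity
  have hl1 : l < 1 := by rw [hl, div_lt_one hμ0]; linarith
  have hη := sub_sq_half_le_one_sub_exp_neg hl0.le
  have hη0 : 0 < 1 - Real.exp (-l) := by nlinarith
  have hlap := repLaplace_le_exp p hp hp1 hl0 hm0 hm n
  have hgμ : (1 - l / 2) * μ ≤
      n * (n - 1) / (n + 2 * (l * m / (1 - Real.exp (-l)))) := by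
    have hDle : l * m / (1 - Real.exp (-l)) ≤ m / (1 - l / 2) := by
      rw [div_le_div_iff₀ hη0 (by linarith)]
      nlinarith
    have hnn : (0 : ℝ) ≤ n * (n - 1) := by
      have : (0 : ℝ) < n + 2 * m := by positivity
      by_contra! hneg
      exact absurd hμ0 (not_lt.2 (div_nonpos_of_nonpos_of_nonneg hneg.le this.le))
    have hh : 0 < 1 - l / 2 := by linarith
    have e : (1 - l / 2) * μ = n * (n - 1) / (n / (1 - l / 2) + 2 * (m / (1 - l / 2))) := by
      rw [hμ]; field_simp
    rw [e]
    refine div_le_div_of_nonneg_left hnn (by positivity) ?_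
    have : (n : ℝ) ≤ n / (1 - l / 2) := by
      rw [le_div_iff₀ hh]; nlinarith
    linarith
  have hstep : ∀ u : Fin n → ι,
      (if n - (Finset.univ.image u).card < r then ∏ i, p (u i) else 0) ≤
      Real.exp (l * (μ - t)) * ((∏ i, p (u i)) *
        Real.exp (-l * (n - (Finset.univ.image u).card))) := by
    intro u
    have hnn : 0 ≤ ∏ i, p (u i) := Finset.prod_nonneg fun i _ => hp _
    split_ifs with h
    · rw [hr, Nat.lt_ceil, max_eq_left hpos.le] at h
      have hc : (Finset.univ.image u).card ≤ n :=
        Finset.card_image_le.trans (by simp)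
      rw [Nat.cast_sub hc] at h
      have : 1 ≤ Real.exp (l * (μ - t)) *
          Real.exp (-l * (n - (Finset.univ.image u).card)) := by
        rw [← Real.exp_add, Real.one_le_exp_iff]
        have := mul_le_mul_of_nonneg_left h.le hl0.le
        linarith
      calc _ = (∏ i, p (u i)) * 1 := (mul_one _).symm
        _ ≤ _ := mul_le_mul_of_nonneg_left this hnn
        _ = _ := by ring
    · positivity
  refine (Finset.sum_le_sum fun u _ => hstep u).trans ?_
  rw [← Finset.mul_sum]
  change Real.exp (l * (μ - t)) * repLaplace p l n ≤ a
  calc _ ≤ Real.exp (l * (μ - t)) * Real.exp (-l * ((1 - l / 2) * μ)) := by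
        refine mul_le_mul_of_nonneg_left (hlap.trans (Real.exp_le_exp.2 ?_)) (Real.exp_pos _).le
        rw [neg_mul, neg_mul, neg_le_neg_iff]
        exact mul_le_mul_of_nonneg_left hgμ hl0.le
    _ = Real.exp (-(2 * L)) := by
        rw [← Real.exp_add]
        congr 1
        have : l * t = 4 * L := by rw [hl]; field_simp; rw [htsq]; ring
        have h2 : l * μ = t := by rw [hl]; field_simp
        have : l * (μ - t) + -l * ((1 - l / 2) * μ) = l / 2 * (l * μ) - l * t := by ring
        rw [this, h2]; linarith
    _ ≤ Real.exp (-L) := Real.exp_le_exp.2 (by linarith)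
    _ = a := by rw [hL, one_div, Real.log_inv, neg_neg, Real.exp_log ha0]

end Finite

/-- Nearest-point projection onto a finite set of reals can be chosen measurable. -/
lemma exists_measurable_nearest {s : Finset ℝ} (hs : s.Nonempty) :
    ∃ b : ℝ → ℝ, Measurable b ∧ ∀ y, b y ∈ s ∧ ∀ v ∈ s, (b y - y) ^ 2 ≤ (v - y) ^ 2 := by
  classical
  induction hs using Finset.Nonempty.cons_induction with
  | singleton a => exact ⟨fun _ => a, measurable_const, by simp⟩
  | cons a s ha hs ih =>
    obtain ⟨b, hb, hmin⟩ := ih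
    refine ⟨fun y => if (a - y) ^ 2 ≤ (b y - y) ^ 2 then a else b y,
      Measurable.ite (measurableSet_le (by fun_prop) (by fun_prop)) measurable_const hb,
      fun y => ?_⟩
    dsimp only
    split_ifs with h
    · refine ⟨Finset.mem_cons_self _ _, fun v hv => ?_⟩
      rcases Finset.mem_cons.1 hv with rfl | hv
      · exact le_rfl
      · exact h.trans ((hmin y).2 v hv)
    · refine ⟨Finset.mem_cons_of_mem (hmin y).1, fun v hv => ?_⟩
      rcases Finset.mem_cons.1 hv with rfl | hv
      · exact (not_le.1 h).le
      · exact (hmin y).2 v hv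

/-- The atoms of the first marginal. -/
def fstAtoms {X Y : Type*} [MeasurableSpace X] [MeasurableSpace Y] (P : Measure (X × Y)) : Set X :=
  {x | 0 < P {z | z.1 = x}}

lemma countable_fstAtoms {X Y : Type*} [MeasurableSpace X] [MeasurableSpace Y]
    [MeasurableSingletonClass X] (P : Measure (X × Y)) [SFinite P] : (fstAtoms P).Countable :=
  Measure.countable_meas_level_set_pos measurable_fst

/-- A finitely valued, not necessarily measurable, predictor is dominated by a measurable labelling
of the examples which depends on the input alone on the atoms of the input distribution. -/
lemma exists_measurable_labelling {X : Type*} [MeasurableSpace X] [MeasurableSingletonClass X]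
    (P : Measure (X × ℝ)) [SFinite P] {s : Finset ℝ} {f : X → ℝ} (hf : ∀ x, f x ∈ s)
    (hs : s.Nonempty) :
    ∃ v : X × ℝ → s, Measurable v ∧ (∀ z, ((v z : ℝ) - z.2) ^ 2 ≤ (f z.1 - z.2) ^ 2) ∧
      ∀ z, z.1 ∈ fstAtoms P → (v z : ℝ) = f z.1 := by
  classical
  obtain ⟨b, hb, hmin⟩ := exists_measurable_nearest hs
  have hC := countable_fstAtoms P
  have hg : Measurable ((fstAtoms P).indicator f) := by
    refine Measurable.measurable_of_countable_ne (f := fun _ => (0 : ℝ)) measurable_const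
      (hC.mono fun x hx => ?_)
    by_contra h
    exact hx (Set.indicator_of_notMem h f).symm
  set J : X × ℝ → ℝ := fun z =>
    if z.1 ∈ fstAtoms P then (fstAtoms P).indicator f z.1 else b z.2 with hJ
  have hJm : Measurable J := Measurable.ite (measurable_fst hC.measurableSet)
    (hg.comp measurable_fst) (hb.comp measurable_snd)
  have hJC : ∀ z, z.1 ∈ fstAtoms P → J z = f z.1 := fun z hz => by
    simp only [hJ, if_pos hz, Set.indicator_of_mem hz]
  have hJn : ∀ z, z.1 ∉ fstAtoms P → J z = b z.2 := fun z hz => by simp only [hJ, if_neg hz]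
  have hJs : ∀ z, J z ∈ s := fun z => by
    by_cases hz : z.1 ∈ fstAtoms P
    · rw [hJC z hz]; exact hf _
    · rw [hJn z hz]; exact (hmin _).1
  refine ⟨fun z => ⟨J z, hJs z⟩, hJm.subtype_mk, fun z => ?_, hJC⟩
  by_cases hz : z.1 ∈ fstAtoms P
  · exact le_of_eq (by simp only [hJC z hz])
  · simp only [hJn z hz]; exact (hmin _).2 _ (hf _)

lemma measurableSet_fst_eq_notMem_fstAtoms {X Y : Type*} [MeasurableSpace X] [MeasurableEq X]
    [MeasurableSpace Y] [MeasurableSingletonClass X]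
    (P : Measure (X × Y)) [SFinite P] {Ω : Type*} [MeasurableSpace Ω] {a b : Ω → X × Y}
    (ha : Measurable a) (hb : Measurable b) :
    MeasurableSet {D | (a D).1 = (b D).1 ∧ (a D).1 ∉ fstAtoms P} :=
  (measurableSet_eq_fun ha.fst hb.fst).inter (ha.fst (countable_fstAtoms P).measurableSet.compl)

/-- Two distinct sample points almost surely do not share an input that is not an atom. -/
lemma measure_pi_fst_eq_notMem_fstAtoms {X Y ι : Type*} [Fintype ι] [MeasurableSpace X]
    [MeasurableSpace Y] [MeasurableEq X] [MeasurableSingletonClass X]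
    (P : Measure (X × Y)) [IsProbabilityMeasure P] {i k : ι} (hik : i ≠ k) :
    Measure.pi (fun _ : ι => P) {D | (D i).1 = (D k).1 ∧ (D i).1 ∉ fstAtoms P} = 0 := by
  have hind := (ProbabilityTheory.iIndepFun_pi (μ := fun _ : ι => P) (X := fun _ z => z)
    (fun _ => aemeasurable_id)).indepFun hik
  have hmap := (ProbabilityTheory.indepFun_iff_map_prod_eq_prod_map_map
    (measurable_pi_apply i).aemeasurable (measurable_pi_apply k).aemeasurable).1 hind
  rw [(measurePreserving_eval (fun _ : ι => P) i).map_eq,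
    (measurePreserving_eval (fun _ : ι => P) k).map_eq] at hmap
  have hE := measurableSet_fst_eq_notMem_fstAtoms P
    (measurable_fst (α := X × Y) (β := X × Y)) measurable_snd
  have hpre : {D : ι → X × Y | (D i).1 = (D k).1 ∧ (D i).1 ∉ fstAtoms P} =
      (fun D : ι → X × Y => (D i, D k)) ⁻¹'
        {w | w.1.1 = w.2.1 ∧ w.1.1 ∉ fstAtoms P} := rfl
  rw [hpre, ← Measure.map_apply ((measurable_pi_apply i).prodMk (measurable_pi_apply k)) hE, hmap,
    Measure.measure_prod_null hE]
  refine Filter.Eventually.of_forall fun z => ?_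
  by_cases hz : z.1 ∈ fstAtoms P
  · have : Prod.mk z ⁻¹' {w : (X × Y) × (X × Y) | w.1.1 = w.2.1 ∧ w.1.1 ∉ fstAtoms P} = ∅ := by
      ext w; simp [hz]
    exact (congrArg P this).trans measure_empty
  · have h0 : P {w | w.1 = z.1} = 0 := by
      by_contra h
      exact hz (pos_iff_ne_zero.2 h)
    exact measure_mono_null (fun w hw => hw.1.symm) h0

/-- Lower tail bound for the number of repeated labels, in terms of measures. -/
lemma measure_pi_few_rep_le {Z ι : Type*} [MeasurableSpace Z] [Fintype ι] [DecidableEq ι]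
    [MeasurableSpace ι] [MeasurableSingletonClass ι] (P : Measure Z) [IsProbabilityMeasure P]
    {v : Z → ι} (hv : Measurable v) {m : ℕ} (hm0 : 0 < m) (hm : Fintype.card ι ≤ m) (n r : ℕ)
    {a : ℝ} (ha0 : 0 < a) (ha1 : a < 1)
    (hr : r = ⌈max ((n : ℝ) * ((n : ℝ) - 1) / ((n : ℝ) + 2 * m)
        - 2 * Real.sqrt ((n : ℝ) * ((n : ℝ) - 1) / ((n : ℝ) + 2 * m)
            * Real.log (1 / a))) 0⌉₊) :
    Measure.pi (fun _ : Fin n => P)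
      {D | n - (Finset.univ.image fun i => v (D i)).card < r} ≤ ENNReal.ofReal a := by
  classical
  set ν := P.map v with hν
  have : IsProbabilityMeasure ν := Measure.isProbabilityMeasure_map hv.aemeasurable
  have hmap := Measure.pi_map_pi (μ := fun _ : Fin n => P) (f := fun _ => v)
    (fun _ => hv.aemeasurable)
  set B : Finset (Fin n → ι) := {u | n - (Finset.univ.image u).card < r} with hB
  have hpre : {D : Fin n → Z | n - (Finset.univ.image fun i => v (D i)).card < r} =
      (fun D i => v (D i)) ⁻¹' (B : Set (Fin n → ι)) := by
    ext D; simp [hB]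
  have hvD : Measurable fun (D : Fin n → Z) i => v (D i) :=
    measurable_pi_lambda _ fun i => hv.comp (measurable_pi_apply i)
  rw [hpre, ← Measure.map_apply hvD B.measurableSet, hmap, ← sum_measure_singleton]
  have hsum := sum_few_rep_le (fun j => ν.real {j}) (fun j => measureReal_nonneg)
    (by rw [sum_measureReal_singleton]; simp) hm0 hm n r ha0 ha1 hr
  rw [← Finset.sum_filter] at hsum
  refine le_trans (le_of_eq ?_) (ENNReal.ofReal_le_ofReal hsum)
  rw [ENNReal.ofReal_sum_of_nonneg fun u _ => Finset.prod_nonneg fun i _ => measureReal_nonneg]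
  refine Finset.sum_congr rfl fun u _ => ?_
  rw [Measure.pi_singleton, ENNReal.ofReal_prod_of_nonneg fun i _ => measureReal_nonneg]
  exact Finset.prod_congr rfl fun i _ => (ofReal_measureReal).symm

/-- A labelling of the sample which is a function of the inputs and uses few labels bounds the
empirical model class risk. -/
lemma pwcEmpClassRisk_le {d k n : ℕ} (hn : 0 < n) (D : Fin n → (Fin d → ℝ) × ℝ) (w : Fin n → ℝ)
    (hw : ∀ i j, (D i).1 = (D j).1 → w i = w j) (hk : (Finset.univ.image w).card ≤ k) :
    pwcEmpClassRisk d k n D ≤ (∑ i, ENNReal.ofReal ((w i - (D i).2) ^ 2)) / n := by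
  classical
  let f : (Fin d → ℝ) → ℝ := fun x =>
    if h : ∃ i, (D i).1 = x then w h.choose else w ⟨0, hn⟩
  have hfD : ∀ i, f (D i).1 = w i := fun i => by
    have h : ∃ j, (D j).1 = (D i).1 := ⟨i, rfl⟩
    simp only [f, dif_pos h]
    exact hw _ _ h.choose_spec
  have hf : f ∈ Fpwc d k := by
    refine ⟨_, hk, fun x => ?_⟩
    simp only [f]
    split_ifs <;> exact Finset.mem_image_of_mem _ (Finset.mem_univ _)
  refine (iInf₂_le f hf).trans (le_of_eq ?_)
  simp only [hfD]

/-- Markov's inequality for the empirical mean of a nonnegative function. -/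
lemma measure_pi_lt_mean_le {Z : Type*} [MeasurableSpace Z] (P : Measure Z)
    [IsProbabilityMeasure P] {h : Z → ℝ≥0∞} (hh : Measurable h) {n : ℕ} (hn : 0 < n)
    {a c : ℝ≥0∞} (hc0 : c ≠ 0) (hc : c ≠ ∞) (hhc : ∫⁻ z, h z ∂P ≤ c) :
    Measure.pi (fun _ : Fin n => P) {D | c < a * ((∑ i, h (D i)) / n)} ≤ a := by
  have hF : Measurable fun D : Fin n → Z => a * ((∑ i, h (D i)) / n) := by fun_prop
  have hint : ∫⁻ D, a * ((∑ i, h (D i)) / n) ∂Measure.pi (fun _ : Fin n => P) =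
      a * ∫⁻ z, h z ∂P := by
    have hi : ∀ i : Fin n, ∫⁻ D, h (D i) ∂Measure.pi (fun _ : Fin n => P) = ∫⁻ z, h z ∂P :=
      fun i => (measurePreserving_eval (fun _ : Fin n => P) i).lintegral_comp hh
    rw [lintegral_const_mul _ (by fun_prop)]
    simp only [div_eq_mul_inv]
    rw [lintegral_mul_const _ (by fun_prop), lintegral_finsetSum _ (by fun_prop)]
    simp only [hi, Finset.sum_const, Finset.card_univ, Fintype.card_fin, nsmul_eq_mul]
    rw [mul_comm (n : ℝ≥0∞), mul_assoc, ENNReal.mul_inv_cancel (by exact_mod_cast hn.ne')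
      (ENNReal.natCast_ne_top n), mul_one]
  have hM := mul_meas_ge_le_lintegral (μ := Measure.pi (fun _ : Fin n => P)) hF c
  rw [hint] at hM
  have h2 : c * Measure.pi (fun _ : Fin n => P) {D | c < a * ((∑ i, h (D i)) / n)} ≤ c * a :=
    calc _ ≤ c * Measure.pi (fun _ : Fin n => P) {D | c ≤ a * ((∑ i, h (D i)) / n)} := by
          gcongr with D; exact fun hD => hD.le
      _ ≤ a * c := hM.trans (by gcongr)
      _ = c * a := mul_comm _ _
  exact (ENNReal.mul_le_mul_iff_right hc0 hc).1 h2

/-- For a single predictor, the lower bound holds on a measurable event of large probability. -/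
lemma exists_event_of_risk_le {d n m r : ℕ} {a₀ a₁ : ℝ} (ha₀ : 0 < a₀) (ha₁ : 0 < a₁)
    (ha : a₀ + a₁ < 1) (hn : 0 < n) (hm : 0 < m)
    (hr : r = ⌈max ((n : ℝ) * ((n : ℝ) - 1) / ((n : ℝ) + 2 * m)
        - 2 * Real.sqrt ((n : ℝ) * ((n : ℝ) - 1) / ((n : ℝ) + 2 * m)
            * Real.log (1 / a₀))) 0⌉₊)
    (P : Measure ((Fin d → ℝ) × ℝ)) [IsProbabilityMeasure P] {f : (Fin d → ℝ) → ℝ}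
    (hf : f ∈ Fpwc d m) {c : ℝ≥0∞} (hc0 : c ≠ 0) (hc : c ≠ ∞)
    (hfc : ∫⁻ z, ENNReal.ofReal ((f z.1 - z.2) ^ 2) ∂P ≤ c) :
    ∃ G, MeasurableSet G ∧
      ENNReal.ofReal (1 - (a₀ + a₁)) ≤ Measure.pi (fun _ : Fin n => P) G ∧
      ∀ D ∈ G, ENNReal.ofReal a₁ * pwcEmpClassRisk d (n - r) n D ≤ c := by
  classical
  obtain ⟨s, hsm, hfs⟩ := hf
  obtain ⟨v, hv, hvf, hvC⟩ := exists_measurable_labelling P hfs ⟨_, hfs 0⟩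
  set μ := Measure.pi (fun _ : Fin n => P) with hμ
  set h : (Fin d → ℝ) × ℝ → ℝ≥0∞ := fun z => ENNReal.ofReal (((v z : ℝ) - z.2) ^ 2) with hh
  have hhm : Measurable h :=
    (((measurable_subtype_coe.comp hv).sub measurable_snd).pow_const 2).ennreal_ofReal
  set T : Set (Fin n → (Fin d → ℝ) × ℝ) :=
    ⋃ (i : Fin n) (k : Fin n) (_ : i ≠ k), {D | (D i).1 = (D k).1 ∧ (D i).1 ∉ fstAtoms P} with hT
  set B : Set (Fin n → (Fin d → ℝ) × ℝ) :=
    {D | n - (Finset.univ.image fun i => v (D i)).card < r} with hB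
  set M : Set (Fin n → (Fin d → ℝ) × ℝ) :=
    {D | c < ENNReal.ofReal a₁ * ((∑ i, h (D i)) / n)} with hM
  have hTm : MeasurableSet T := .iUnion fun i => .iUnion fun k => .iUnion fun _ =>
    measurableSet_fst_eq_notMem_fstAtoms P (measurable_pi_apply i) (measurable_pi_apply k)
  have hBm : MeasurableSet B :=
    (measurable_pi_lambda (fun (D : Fin n → (Fin d → ℝ) × ℝ) i => v (D i))
      fun i => hv.comp (measurable_pi_apply i))
      (Set.toFinite {u : Fin n → s | n - (Finset.univ.image u).card < r}).measurableSet
  have hMm : MeasurableSet M := measurableSet_lt measurable_const (by fun_prop)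
  have hT0 : μ T = 0 := by
    simp only [hT, measure_iUnion_null_iff]
    exact fun i k hik => measure_pi_fst_eq_notMem_fstAtoms P hik
  have hB0 : μ B ≤ ENNReal.ofReal a₀ :=
    measure_pi_few_rep_le P hv hm (by simpa using hsm) n r ha₀ (by linarith) hr
  have hM0 : μ M ≤ ENNReal.ofReal a₁ := measure_pi_lt_mean_le P hhm hn hc0 hc
    ((lintegral_mono fun z => ENNReal.ofReal_le_ofReal (hvf z)).trans hfc)
  refine ⟨(T ∪ B ∪ M)ᶜ, ((hTm.union hBm).union hMm).compl, ?_, fun D hD => ?_⟩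
  · rw [prob_compl_eq_one_sub ((hTm.union hBm).union hMm), ENNReal.ofReal_sub _ (by positivity),
      ENNReal.ofReal_one]
    refine tsub_le_tsub_left ?_ _
    rw [ENNReal.ofReal_add ha₀.le ha₁.le]
    refine (measure_union_le _ _).trans (add_le_add ((measure_union_le _ _).trans ?_) hM0)
    rw [hT0, zero_add]
    exact hB0
  · simp only [Set.mem_compl_iff, Set.mem_union, not_or] at hD
    obtain ⟨⟨hDT, hDB⟩, hDM⟩ := hD
    refine le_trans ?_ (not_lt.1 hDM)
    gcongr
    refine pwcEmpClassRisk_le hn D (fun i => (v (D i) : ℝ)) (fun i k hik => ?_) ?_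
    · by_cases hC : (D i).1 ∈ fstAtoms P
      · rw [hvC _ hC, hvC _ (hik ▸ hC), hik]
      · by_cases e : i = k
        · rw [e]
        · exact absurd (by simp only [hT, Set.mem_iUnion]; exact ⟨i, k, e, hik, hC⟩) hDT
    · have h1 : (Finset.univ.image fun i => (v (D i) : ℝ)).card ≤
          (Finset.univ.image fun i => v (D i)).card := by
        have : (Finset.univ.image fun i => (v (D i) : ℝ)) =
            (Finset.univ.image fun i => v (D i)).image Subtype.val := by
          rw [Finset.image_image]; rfl
        rw [this]
        exact Finset.card_image_le
      have h2 : (Finset.univ.image fun i => v (D i)).card ≤ n :=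
        Finset.card_image_le.trans (by simp)
      have h3 : r ≤ n - (Finset.univ.image fun i => v (D i)).card := not_lt.1 hDB
      omega

/-- A lower bound for the measures of a sequence of events passes to their limit superior. -/
lemma le_measure_iInter_iUnion {Ω : Type*} [MeasurableSpace Ω] (μ : Measure Ω) [IsFiniteMeasure μ]
    {G : ℕ → Set Ω} (hG : ∀ k, MeasurableSet (G k)) {b : ℝ≥0∞} (hb : ∀ k, b ≤ μ (G k)) :
    b ≤ μ (⋂ K, ⋃ k ≥ K, G k) := by
  have hanti : Antitone fun K => ⋃ k ≥ K, G k := fun K K' hK =>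
    Set.biUnion_subset_biUnion_left fun k hk => le_trans hK hk
  have hlim := tendsto_measure_iInter_atTop (μ := μ)
    (fun K => (MeasurableSet.iUnion fun k => .iUnion fun _ => hG k).nullMeasurableSet) hanti
    ⟨0, measure_ne_top _ _⟩
  exact ge_of_tendsto' hlim fun K => (hb K).trans
    (measure_mono (Set.subset_biUnion_of_mem (u := G) (le_refl K)))

/-- With
`r = ⌈( n(n−1)/(n+2m) − 2√( n(n−1)/(n+2m) · log(1/α₀) ) )₊⌉`, the quantity
`α₁ · R̂(F_pwc^(n−r), D_n)` is a valid distribution-free lower bound on the model class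
risk `R_P(F_pwc^(m))`. -/
theorem pwc_lower_bound_valid_refined
    (d : ℕ) (α α₀ α₁ : ℝ) (hα : α ∈ Set.Ioo (0 : ℝ) 1)
    (hα₀ : 0 < α₀) (hα₁ : 0 < α₁) (hsum : α₀ + α₁ = α)
    (n m : ℕ) (hn : 1 ≤ n) (hm : 1 ≤ m)
    (r : ℕ)
    (hr : r = ⌈max ((n : ℝ) * ((n : ℝ) - 1) / ((n : ℝ) + 2 * m)
        - 2 * Real.sqrt ((n : ℝ) * ((n : ℝ) - 1) / ((n : ℝ) + 2 * m)
            * Real.log (1 / α₀))) 0⌉₊)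
    (P : Measure ((Fin d → ℝ) × ℝ)) [IsProbabilityMeasure P] :
    ENNReal.ofReal (1 - α) ≤
      Measure.pi (fun _ : Fin n => P)
        {D | ENNReal.ofReal α₁ * pwcEmpClassRisk d (n - r) n D ≤ pwcClassRisk d m P} := by
  by_cases htop : pwcClassRisk d m P = ∞
  · simp only [htop, le_top, Set.ofPred_true, measure_univ]
    exact ENNReal.ofReal_le_one.2 (by linarith [hα.1])
  set R := pwcClassRisk d m P with hR
  have hkpos : ∀ k : ℕ, ((k : ℝ≥0∞) + 1)⁻¹ ≠ 0 := fun k =>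
    ENNReal.inv_ne_zero.2 (by finiteness)
  have hktop : ∀ k : ℕ, ((k : ℝ≥0∞) + 1)⁻¹ ≠ ∞ := fun k =>
    ENNReal.inv_ne_top.2 (by simp)
  have hex : ∀ k : ℕ, ∃ G, MeasurableSet G ∧
      ENNReal.ofReal (1 - α) ≤ Measure.pi (fun _ : Fin n => P) G ∧
      ∀ D ∈ G, ENNReal.ofReal α₁ * pwcEmpClassRisk d (n - r) n D ≤
        R + ((k : ℝ≥0∞) + 1)⁻¹ := by
    intro k
    have hlt : R < R + ((k : ℝ≥0∞) + 1)⁻¹ := ENNReal.lt_add_right htop (hkpos k)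
    obtain ⟨f, hf, hfc⟩ : ∃ f ∈ Fpwc d m,
        ∫⁻ z, ENNReal.ofReal ((f z.1 - z.2) ^ 2) ∂P < R + ((k : ℝ≥0∞) + 1)⁻¹ := by
      simpa [hR, pwcClassRisk, iInf_lt_iff] using hlt
    rw [← hsum]
    exact exists_event_of_risk_le hα₀ hα₁ (hsum ▸ hα.2) hn hm hr P hf
      (pos_of_gt hlt).ne' (ENNReal.add_ne_top.2 ⟨htop, hktop k⟩) hfc.le
  choose G hGm hGμ hG using hex
  refine (le_measure_iInter_iUnion _ hGm hGμ).trans (measure_mono fun D hD => ?_)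
  simp only [Set.mem_iInter, Set.mem_iUnion] at hD
  have hlim : Filter.Tendsto (fun K : ℕ => R + ((K : ℝ≥0∞) + 1)⁻¹) Filter.atTop (nhds (R + 0)) := by
    refine tendsto_const_nhds.add ?_
    have := (Filter.tendsto_add_atTop_iff_nat 1).2 ENNReal.tendsto_inv_nat_nhds_zero
    simpa using this
  rw [add_zero] at hlim
  refine ge_of_tendsto' hlim fun K => ?_
  obtain ⟨k, hk, hDk⟩ := hD K
  refine (hG k D hDk).trans ?_
  gcongr
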